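/- arXiv:2305.04127 — 2 statements merged into one kernel-verified Lean document; each statement's English description precedes it below -/
import Mathlib

section
/- For every R > 0, M > 0 and integer k ≥ 1 there exists a constant C > 0 (depending only on R, M, k) such that for every sufficiently small δ > 0 and every integer ℓ ≥ C · log(1/δ) / log log(1/δ) with ℓ ≥ 2(2k−1), the following holds. Let w_1, …, w_k > 0 with Σ_i w_i = 1, μ_1, …, μ_k ∈ [−M, M], and m_j := Σ_i w_i μ_i^j. Then for each 1 ≤ i ≤ 2k−1, the series Σ_{j=ℓ}^∞ J_{f_i, j} · m_j converges absolutely and |Σ_{j=ℓ}^∞ J_{f_i, j} · m_j| ≤ δ, where f_i := Σ_{a=0}^{ℓ−1} (β_i)_a · h_a and β_i := V^{−1} e_i. -/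
open MeasureTheory Real Finset Matrix

/-- Probabilists' Hermite polynomial evaluated at a real number. -/
noncomputable def hermiteR (j : ℕ) (x : ℝ) : ℝ := Polynomial.aeval x (Polynomial.hermite j)

/-- `J_{f,j} = ∫_S f(x) · (1/(√(2π)·j!)) · e^{-x²/2} · h_j(x) dx`, where `S = [-R, R]`. -/
noncomputable def Jint (R : ℝ) (f : ℝ → ℝ) (j : ℕ) : ℝ :=
  ∫ x in Set.Icc (-R) R,
    f x * (1 / (Real.sqrt (2 * π) * (Nat.factorial j))) * Real.exp (-x ^ 2 / 2) * hermiteR j x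

/-- The `ℓ×ℓ` matrix `V` with entries `V_{r,c} = J_{h_c, r}`. -/
noncomputable def Vmat (R : ℝ) (ℓ : ℕ) : Matrix (Fin ℓ) (Fin ℓ) ℝ :=
  Matrix.of fun r c : Fin ℓ => Jint R (hermiteR c) r


lemma tsb_int_cos (k : ℤ) : ∫ θ in (0:ℝ)..π, cos (k * θ) = if k = 0 then π else 0 := by
  have h := Polynomial.Chebyshev.integral_measureT_eq_integral_cos
    (f := fun x => (Polynomial.Chebyshev.T ℝ k).eval x)
  simp only [Polynomial.Chebyshev.T_real_cos] at h
  rw [← h]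
  split_ifs with hk
  · subst hk; exact Polynomial.Chebyshev.integral_eval_T_real_measureT_zero
  · exact Polynomial.Chebyshev.integral_eval_T_real_measureT_of_ne_zero hk

lemma tsb_int_sin (n m : ℕ) :
    ∫ θ in (0:ℝ)..π, sin ((n + 1) * θ) * sin ((m + 1) * θ) = if n = m then π / 2 else 0 := by
  have h : ∀ θ : ℝ, sin ((n + 1) * θ) * sin ((m + 1) * θ) =
      (1/2) * cos (((n - m : ℤ) : ℝ) * θ) - (1/2) * cos (((n + m + 2 : ℤ) : ℝ) * θ) := by
    intro θ
    push_cast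
    have e1 : ((n:ℝ) - m) * θ = (n+1) * θ - (m+1) * θ := by ring
    have e2 : ((n:ℝ) + m + 2) * θ = (n+1) * θ + (m+1) * θ := by ring
    rw [e1, e2, cos_sub, cos_add]; ring
  simp_rw [h]
  rw [intervalIntegral.integral_sub (by apply Continuous.intervalIntegrable; fun_prop)
    (by apply Continuous.intervalIntegrable; fun_prop),
    intervalIntegral.integral_const_mul, intervalIntegral.integral_const_mul, tsb_int_cos,
    tsb_int_cos]
  have : ¬ ((n:ℤ) + m + 2 = 0) := by omega
  rw [if_neg this]
  by_cases hnm : n = m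
  · subst hnm; simp; ring
  · have : ¬ ((n:ℤ) - m = 0) := by omega
    rw [if_neg this, if_neg hnm]; simp

open Polynomial in
lemma tsb_U_expand (l : ℕ) : ∀ p : ℝ[X], p.degree < l →
    ∃ u : ℕ → ℝ, p = ∑ n ∈ range l, C (u n) * Chebyshev.U ℝ n := by
  induction l with
  | zero =>
    intro p hp
    have : p = 0 := by simpa using hp
    exact ⟨0, by simp [this]⟩
  | succ l ih =>
    intro p hp
    have hU : (Chebyshev.U ℝ (l:ℤ)).degree = l := Chebyshev.degree_U_natCast ℝ l
    have hUn : (Chebyshev.U ℝ (l:ℤ)).natDegree = l := Chebyshev.natDegree_U_natCast ℝ l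
    set c := p.coeff l / (Chebyshev.U ℝ (l:ℤ)).coeff l with hc
    have hne : (Chebyshev.U ℝ (l:ℤ)).coeff l ≠ 0 := by
      have h0 : Chebyshev.U ℝ (l:ℤ) ≠ 0 := by
        intro h; rw [h] at hU; simp at hU
      have := leadingCoeff_ne_zero.mpr h0
      rwa [leadingCoeff, hUn] at this
    have hd : (p - C c * Chebyshev.U ℝ (l:ℤ)).degree < l := by
      rw [degree_lt_iff_coeff_zero]
      intro m hm
      rcases hm.eq_or_lt with rfl | hm
      · simp [hc, hne]
      · have h1 : p.coeff m = 0 := by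
          rw [degree_lt_iff_coeff_zero] at hp; exact hp m (by omega)
        have h2 : (Chebyshev.U ℝ (l:ℤ)).coeff m = 0 :=
          coeff_eq_zero_of_natDegree_lt (by omega)
        simp [h1, h2]
    obtain ⟨u, hu⟩ := ih _ hd
    refine ⟨fun n => if n = l then c else u n, ?_⟩
    rw [sum_range_succ]
    simp only [if_true]
    rw [sum_congr rfl (g := fun n : ℕ => C (u n) * Chebyshev.U ℝ n), ← hu]
    · ring
    · intro n hn
      rw [if_neg (by have := mem_range.mp hn; omega)]

open Polynomial in
lemma tsb_U_coeff (n : ℕ) : ∀ m, |(Chebyshev.U ℝ (n:ℤ)).coeff m| ≤ 3 ^ n := by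
  induction n using Nat.twoStepInduction with
  | zero =>
    intro m; simp [coeff_one]; split_ifs <;> simp
  | one =>
    intro m
    have : (2 * X : ℝ[X]) = C 2 * X := rfl
    simp [this, coeff_X]; split_ifs <;> norm_num
  | more n h1 h2 =>
    intro m
    have e : Chebyshev.U ℝ ((n + 2 : ℕ) : ℤ) =
      C 2 * (X * Chebyshev.U ℝ ((n+1:ℕ):ℤ)) - Chebyshev.U ℝ (n:ℤ) := by
      push_cast; rw [Chebyshev.U_add_two, mul_assoc]; rfl
    rw [e, coeff_sub, coeff_C_mul]
    have h3 : |(X * Chebyshev.U ℝ ((n+1:ℕ):ℤ)).coeff m| ≤ 3 ^ (n+1) := by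
      cases m with
      | zero => simp
      | succ m => rw [coeff_X_mul]; exact h2 m
    have h4 := h1 m
    rw [abs_le] at *
    have : (3:ℝ)^(n+1) = 3 * 3^n := by ring
    have h6 : (3:ℝ)^(n+2) = 9 * 3^n := by ring
    have : (0:ℝ) < 3^n := by positivity
    constructor <;> linarith [h3.1, h3.2, h4.1, h4.2]

open Polynomial in
lemma tsb_parseval (l : ℕ) (u : ℕ → ℝ) :
    ∫ θ in (0:ℝ)..π, ((∑ n ∈ range l, C (u n) * Chebyshev.U ℝ n).eval (cos θ) * sin θ) ^ 2
      = ∑ n ∈ range l, u n ^ 2 * (π / 2) := by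
  have h : ∀ θ : ℝ, ((∑ n ∈ range l, C (u n) * Chebyshev.U ℝ n).eval (cos θ) * sin θ) ^ 2
      = ∑ n ∈ range l, ∑ m ∈ range l,
        (u n * u m) * (sin ((n + 1) * θ) * sin ((m + 1) * θ)) := by
    intro θ
    rw [eval_finsetSum, sum_mul, sq, sum_mul_sum]
    refine sum_congr rfl fun n _ => sum_congr rfl fun m _ => ?_
    have h1 := Chebyshev.U_real_cos θ n
    have h2 := Chebyshev.U_real_cos θ m
    push_cast at h1 h2
    rw [← h1, ← h2, eval_mul, eval_mul, eval_C, eval_C]; ring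
  simp_rw [h]
  rw [intervalIntegral.integral_finsetSum (fun n _ => by
    apply Continuous.intervalIntegrable; fun_prop)]
  refine sum_congr rfl fun n hn => ?_
  rw [intervalIntegral.integral_finsetSum (fun n _ => by
    apply Continuous.intervalIntegrable; fun_prop)]
  simp_rw [intervalIntegral.integral_const_mul, tsb_int_sin]
  simp only [mul_ite, mul_zero, sum_ite_eq, hn, if_true]
  ring

open Polynomial in
lemma tsb_subst (p : ℝ[X]) :
    ∫ θ in (0:ℝ)..π, (p.eval (cos θ) * sin θ) ^ 2 ≤ ∫ x in (-1:ℝ)..1, p.eval x ^ 2 := by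
  have h1 : ∫ x in (0:ℝ)..π, ((fun y => p.eval y ^ 2) ∘ cos) x * (- sin x)
      = ∫ x in cos 0..cos π, p.eval x ^ 2 :=
    intervalIntegral.integral_comp_mul_deriv (fun x _ => hasDerivAt_cos x)
      (by fun_prop) (by fun_prop)
  rw [cos_zero, cos_pi] at h1
  have h2 : ∫ x in (-1:ℝ)..1, p.eval x ^ 2 = ∫ x in (0:ℝ)..π, p.eval (cos x) ^ 2 * sin x := by
    rw [intervalIntegral.integral_symm, ← h1, ← intervalIntegral.integral_neg]
    simp
  rw [h2]
  apply intervalIntegral.integral_mono_on pi_pos.le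
    (by apply Continuous.intervalIntegrable; fun_prop)
    (by apply Continuous.intervalIntegrable; fun_prop)
  intro x hx
  have h3 : 0 ≤ sin x := sin_nonneg_of_mem_Icc hx
  have h4 : sin x ≤ 1 := sin_le_one x
  rw [mul_pow]
  apply mul_le_mul_of_nonneg_left _ (sq_nonneg _)
  nlinarith

open Polynomial in
lemma tsb_coeff_bound (l : ℕ) (p : ℝ[X]) (hp : p.degree < l) (m : ℕ) :
    |p.coeff m| ≤ 3 ^ l * √(∫ x in (-1:ℝ)..1, p.eval x ^ 2) := by
  obtain ⟨u, hu⟩ := tsb_U_expand l p hp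
  set Q := ∫ x in (-1:ℝ)..1, p.eval x ^ 2 with hQ
  have h1 := tsb_subst p
  rw [← hQ, hu, tsb_parseval] at h1
  have h2 : ∀ n ∈ range l, |u n| ≤ √Q := by
    intro n hn
    have h3 := single_le_sum (f := fun n => u n ^ 2 * (π / 2))
      (fun i _ => by positivity) hn
    apply abs_le_sqrt
    have h4 : u n ^ 2 * (π/2) ≤ Q := h3.trans h1
    have := pi_gt_three
    nlinarith [sq_nonneg (u n)]
  have h5 : ∀ l : ℕ, ∑ n ∈ range l, (3:ℝ)^n ≤ 3^l := by
    intro l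
    induction l with
    | zero => simp
    | succ l ih => rw [sum_range_succ, pow_succ]; linarith [pow_pos (show (0:ℝ) < 3 by norm_num) l]
  rw [hu, finsetSum_coeff]
  calc _ ≤ ∑ n ∈ range l, |(C (u n) * Chebyshev.U ℝ n).coeff m| := abs_sum_le_sum_abs _ _
    _ ≤ ∑ n ∈ range l, 3 ^ n * √Q := by
      refine sum_le_sum fun n hn => ?_
      rw [coeff_C_mul, abs_mul, mul_comm]
      exact mul_le_mul (tsb_U_coeff n m) (h2 n hn) (abs_nonneg _) (by positivity)
    _ ≤ _ := by rw [← sum_mul]; exact mul_le_mul_of_nonneg_right (h5 l) (sqrt_nonneg _)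

/-- Hermite polynomial over ℝ -/
noncomputable def tsbH (j : ℕ) : Polynomial ℝ :=
  (Polynomial.hermite j).map (Int.castRingHom ℝ)

open Polynomial in
lemma tsbH_succ (n : ℕ) : tsbH (n + 1) = X * tsbH n - derivative (tsbH n) := by
  simp [tsbH, hermite_succ, Polynomial.derivative_map]

open Polynomial in
lemma tsbH_zero : tsbH 0 = 1 := by simp [tsbH]

open Polynomial in
lemma tsbH_deriv (n : ℕ) : derivative (tsbH (n + 1)) = ((n + 1 : ℕ) : ℝ[X]) * tsbH n := by
  induction n with
  | zero => simp [tsbH_succ, tsbH_zero]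
  | succ n ih =>
    rw [tsbH_succ (n+1), derivative_sub, derivative_mul, ih]
    rw [derivative_mul, tsbH_succ n]
    simp
    ring

open Polynomial in
lemma tsbH_X_mul (n : ℕ) : X * tsbH n = tsbH (n + 1) + (n : ℝ[X]) * tsbH (n - 1) := by
  cases n with
  | zero => simp [tsbH_succ, tsbH_zero]
  | succ n => rw [tsbH_succ (n+1), tsbH_deriv]; simp

lemma tsbH_coeff (j : ℕ) : ∀ n, |(tsbH j).coeff n| * √(n.factorial) ≤ 2 ^ j * √(j.factorial) := by
  have hz : ∀ j n, j < n → (tsbH j).coeff n = 0 := by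
    intro j n h
    simp [tsbH, Polynomial.coeff_hermite_of_lt h]
  induction j with
  | zero =>
    intro n
    rw [tsbH_zero, Polynomial.coeff_one]
    split_ifs with h
    · subst h; simp
    · simp
  | succ j ih =>
    intro n
    rcases lt_or_ge (j+1) n with hlt | hle
    · rw [hz _ _ hlt]; simp
    have hj : √((j+1).factorial : ℝ) = √(j+1) * √(j.factorial) := by
      rw [← sqrt_mul (by positivity), Nat.factorial_succ]; push_cast; rfl
    have key : ∀ m : ℕ, m ≤ j → |((m:ℝ)+1) * (tsbH j).coeff (m+1)| * √(m.factorial) ≤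
        √(j+1) * (2 ^ j * √(j.factorial)) := by
      intro m hm
      have hm1 : √((m+1).factorial : ℝ) = √(m+1) * √(m.factorial) := by
        rw [← sqrt_mul (by positivity), Nat.factorial_succ]; push_cast; rfl
      have h := ih (m+1)
      rw [hm1] at h
      have h2 : √((m:ℝ)+1) ≤ √(j+1) := sqrt_le_sqrt (by
        have : (m:ℝ) ≤ j := by exact_mod_cast hm
        linarith)
      rw [abs_mul, abs_of_nonneg (by positivity : (0:ℝ) ≤ (m:ℝ)+1)]
      calc _ = √((m:ℝ)+1) * (|(tsbH j).coeff (m+1)| * (√(m+1) * √(m.factorial))) := by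
            nth_rewrite 1 [← mul_self_sqrt (by positivity : (0:ℝ) ≤ (m:ℝ)+1)]; ring
        _ ≤ _ := mul_le_mul h2 h (by positivity) (by positivity)
    have hs : (0:ℝ) ≤ √(j+1) * (2 ^ j * √(j.factorial)) := by positivity
    cases n with
    | zero =>
      have e : (tsbH (j+1)).coeff 0 = - (((0:ℕ):ℝ)+1) * (tsbH j).coeff (0+1) := by
        rw [tsbH_succ]; simp [Polynomial.coeff_derivative]
      rw [e, neg_mul, abs_neg, hj, pow_succ]
      linarith [key 0 (by omega)]
    | succ n =>
      have e : (tsbH (j+1)).coeff (n+1) = (tsbH j).coeff n -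
          (((n+1:ℕ):ℝ)+1) * (tsbH j).coeff (n+1+1) := by
        rw [tsbH_succ]; simp [Polynomial.coeff_derivative]; ring
      have k1 : |(((n+1:ℕ):ℝ)+1) * (tsbH j).coeff (n+1+1)| * √((n+1).factorial) ≤
        √(j+1) * (2 ^ j * √(j.factorial)) := by
        rcases le_or_gt (n+1) j with h | h
        · exact key _ h
        · rw [hz _ _ (by omega)]; simp; positivity
      have k2 : |(tsbH j).coeff n| * √((n+1).factorial) ≤ √(j+1) * (2 ^ j * √(j.factorial)) := by
        have hm1 : √((n+1).factorial : ℝ) = √(n+1) * √(n.factorial) := by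
          rw [← sqrt_mul (by positivity), Nat.factorial_succ]; push_cast; rfl
        have h2 : √((n:ℝ)+1) ≤ √(j+1) := sqrt_le_sqrt (by
          have : (n:ℝ)+1 ≤ j+1 := by exact_mod_cast hle
          linarith)
        rw [hm1]
        calc _ = √((n:ℝ)+1) * (|(tsbH j).coeff n| * √(n.factorial)) := by ring
          _ ≤ _ := mul_le_mul h2 (ih n) (by positivity) (by positivity)
      rw [e, hj, pow_succ]
      have := mul_le_mul_of_nonneg_right (abs_sub ((tsbH j).coeff n)
          ((((n+1:ℕ):ℝ)+1) * (tsbH j).coeff (n+1+1))) (sqrt_nonneg ((n+1).factorial:ℝ))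
      rw [add_mul (|(tsbH j).coeff n|)] at this
      linarith

/-- functional bound -/
lemma tsb_mom (L : Polynomial ℝ →ₗ[ℝ] ℝ) (l : ℕ) (K : ℝ) (hK : 0 ≤ K)
    (hL : ∀ r < l, |L (tsbH r)| ≤ K) (n : ℕ) :
    ∀ r, n + r < l → |L (Polynomial.X ^ n * tsbH r)| ≤ K * (2 ^ n * √((n + r).factorial)) := by
  induction n with
  | zero =>
    intro r hr
    have h1 := hL r (by omega)
    have : (1:ℝ) ≤ √((0 + r).factorial) := by
      rw [zero_add, one_le_sqrt]; exact_mod_cast Nat.succ_le_of_lt (Nat.factorial_pos r)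
    simp only [pow_zero, one_mul]
    nlinarith
  | succ n ih =>
    intro r hr
    have e : Polynomial.X ^ (n+1) * tsbH r = Polynomial.X ^ n * tsbH (r+1) +
        (r:ℝ) • (Polynomial.X ^ n * tsbH (r-1)) := by
      rw [pow_succ, mul_assoc, tsbH_X_mul, Polynomial.smul_eq_C_mul]
      simp; ring
    rw [e, map_add, map_smul, smul_eq_mul]
    have h1 := ih (r+1) (by omega)
    have e2 : n + 1 + r = n + (r+1) := by ring
    rw [e2]
    have h2 : |(r:ℝ) * L (Polynomial.X ^ n * tsbH (r-1))| ≤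
        K * (2 ^ n * √((n + (r+1)).factorial)) := by
      rcases Nat.eq_zero_or_pos r with h0 | h0
      · subst h0; simp; positivity
      · have h3 := ih (r-1) (by omega)
        rw [abs_mul, abs_of_nonneg (by positivity : (0:ℝ) ≤ (r:ℝ))]
        have h4 : (r:ℝ) * √((n + (r-1)).factorial) ≤ √((n + (r+1)).factorial) := by
          apply le_sqrt_of_sq_le
          rw [mul_pow, sq_sqrt (by positivity)]
          obtain ⟨r, rfl⟩ : ∃ s, r = s + 1 := ⟨r-1, by omega⟩
          have : (r+1)^2 * (n + (r+1-1)).factorial ≤ (n + (r+1+1)).factorial := by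
            have e3 : n + (r+1+1) = n + r + 1 + 1 := by ring
            rw [e3, Nat.factorial_succ, Nat.factorial_succ, Nat.add_sub_cancel, ← mul_assoc]
            apply Nat.mul_le_mul_right
            nlinarith
          exact_mod_cast this
        calc _ ≤ (r:ℝ) * (K * (2 ^ n * √((n + (r-1)).factorial))) :=
              mul_le_mul_of_nonneg_left h3 (by positivity)
          _ = K * (2 ^ n * (r * √((n + (r-1)).factorial))) := by ring
          _ ≤ _ := by gcongr
    calc _ ≤ _ := abs_add_le _ _
      _ ≤ _ := add_le_add h1 h2
      _ = _ := by ring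

/-- weighted integral functional -/
noncomputable def tsbI (R : ℝ) : Polynomial ℝ →ₗ[ℝ] ℝ where
  toFun p := ∫ x in Set.Icc (-R) R, p.eval x * exp (-x ^ 2 / 2)
  map_add' p q := by
    simp only [Polynomial.eval_add, add_mul]
    exact integral_add (Continuous.integrableOn_Icc (by fun_prop))
      (Continuous.integrableOn_Icc (by fun_prop))
  map_smul' c p := by
    simp only [Polynomial.eval_smul, smul_eq_mul, RingHom.id_apply, mul_assoc]
    exact integral_const_mul _ _

lemma tsbI_apply (R : ℝ) (p : Polynomial ℝ) :
    tsbI R p = ∫ x in Set.Icc (-R) R, p.eval x * exp (-x ^ 2 / 2) := rfl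

lemma tsbI_sq_nonneg (R : ℝ) (p : Polynomial ℝ) : 0 ≤ tsbI R (p * p) := by
  rw [tsbI_apply]
  apply integral_nonneg
  intro x
  simp only [Polynomial.eval_mul, Pi.zero_apply]
  exact mul_nonneg (mul_self_nonneg _) (exp_pos _).le

lemma tsbI_cs (R : ℝ) (p q : Polynomial ℝ) :
    |tsbI R (p * q)| ≤ √(tsbI R (p * p)) * √(tsbI R (q * q)) := by
  have h : discrim (tsbI R (p*p)) (2 * tsbI R (p*q)) (tsbI R (q*q)) ≤ 0 := by
    apply discrim_le_zero
    intro x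
    have h1 := tsbI_sq_nonneg R (x • p + q)
    have e : (x • p + q) * (x • p + q) = (x * x) • (p * p) + (2 * x) • (p * q) + q * q := by
      simp only [Polynomial.smul_eq_C_mul, Polynomial.C_mul]
      have : (Polynomial.C 2 : Polynomial ℝ) = 2 := rfl
      rw [this]; ring
    rw [e, map_add, map_add, map_smul, map_smul] at h1
    simp only [smul_eq_mul] at h1
    linarith
  rw [discrim] at h
  rw [← sqrt_mul (tsbI_sq_nonneg R p)]
  apply abs_le_sqrt
  nlinarith

lemma tsbI_pow (R : ℝ) (hR : 0 < R) (n : ℕ) :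
    √(tsbI R (Polynomial.X ^ n * Polynomial.X ^ n)) ≤ √(2 * R) * R ^ n := by
  rw [show √(2 * R) * R ^ n = √(2 * R * (R ^ n) ^ 2) by
    rw [sqrt_mul (by positivity : 0 ≤ 2 * R) ((R ^ n) ^ 2), sqrt_sq (by positivity)]]
  apply sqrt_le_sqrt
  rw [tsbI_apply]
  calc _ ≤ ∫ x in Set.Icc (-R) R, (R^n)^2 := by
        apply setIntegral_mono_on (Continuous.integrableOn_Icc (by fun_prop))
          (Continuous.integrableOn_Icc (by fun_prop)) measurableSet_Icc
        intro x hx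
        have h1 : |x| ≤ R := abs_le.mpr hx
        have h2 : exp (-x^2/2) ≤ 1 := exp_le_one_iff.mpr (by nlinarith [sq_nonneg x])
        have h3 : (x^n)^2 ≤ (R^n)^2 := by
          rw [← sq_abs (x^n), abs_pow]; gcongr
        simp only [Polynomial.eval_mul, Polynomial.eval_pow, Polynomial.eval_X]
        nlinarith [exp_pos (-x^2/2), sq_nonneg (x^n)]
    _ = _ := by
      simp [measureReal_def]
      rw [ENNReal.toReal_ofReal (by linarith)]; left; ring

lemma tsbI_coeff (R : ℝ) (hR : 0 < R) (l : ℕ) (p : Polynomial ℝ) (hp : p.degree < l) (m : ℕ) :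
    |p.coeff m| * R ^ m ≤ 3 ^ l * (√(R⁻¹ * exp (R ^ 2 / 2)) * √(tsbI R (p * p))) := by
  set q := p.comp (Polynomial.C R * Polynomial.X) with hq
  have hc : ∀ n, q.coeff n = p.coeff n * R ^ n := fun n => Polynomial.comp_C_mul_X_coeff
  have hqd : q.degree < l := by
    rw [Polynomial.degree_lt_iff_coeff_zero] at hp ⊢
    intro n hn
    rw [hc, hp n hn, zero_mul]
  have h := tsb_coeff_bound l q hqd m
  rw [hc, abs_mul, abs_of_nonneg (by positivity : (0:ℝ) ≤ R^m)] at h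
  refine h.trans ?_
  gcongr
  rw [← sqrt_mul (by positivity)]
  apply sqrt_le_sqrt
  have e : ∫ x in (-1:ℝ)..1, q.eval x ^ 2 = R⁻¹ * ∫ x in (-R)..R, p.eval x ^ 2 := by
    have := intervalIntegral.integral_comp_mul_left (a := -1) (b := 1)
      (fun x => p.eval x ^ 2) hR.ne'
    simp [hq]
    simpa using this
  rw [e, mul_assoc]
  gcongr
  rw [tsbI_apply, intervalIntegral.integral_of_le (by linarith), ← integral_Icc_eq_integral_Ioc,
    ← integral_const_mul]
  apply setIntegral_mono_on (Continuous.integrableOn_Icc (by fun_prop))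
          (Continuous.integrableOn_Icc (by fun_prop)) measurableSet_Icc
  intro x hx
  have h1 : |x| ≤ R := abs_le.mpr hx
  have h2 : 1 ≤ exp (R^2/2) * exp (-x^2/2) := by
    rw [← exp_add]; apply one_le_exp
    have := sq_le_sq' hx.1 hx.2
    linarith
  rw [Polynomial.eval_mul]
  nlinarith [mul_self_nonneg (p.eval x)]

lemma tsb_core (R : ℝ) (hR : 0 < R) (l : ℕ) (F : Polynomial ℝ) (hF : F.degree < l)
    (K : ℝ) (hK : 0 ≤ K) (h : ∀ r < l, |tsbI R (F * tsbH r)| ≤ K) (j : ℕ) (hj : l ≤ j) :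
    |tsbI R (F * tsbH j)| ≤
      (K * (1 + √(R⁻¹ * exp (R ^ 2 / 2)) * √(2 * R))) *
        (48 * max 1 R⁻¹ * max 1 R) ^ j * √(j.factorial) := by
  set E := √(R⁻¹ * exp (R ^ 2 / 2)) with hE
  set ρ := max 1 R⁻¹ with hρ
  set σ := max 1 R with hσ
  set N := √(tsbI R (F * F)) with hN
  have hρ1 : 1 ≤ ρ := le_max_left _ _
  have hσ1 : 1 ≤ σ := le_max_left _ _
  have hE0 : 0 ≤ E := sqrt_nonneg _
  have hN0 : 0 ≤ N := sqrt_nonneg _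
  -- moments
  let L : Polynomial ℝ →ₗ[ℝ] ℝ := (tsbI R).comp (LinearMap.mulLeft ℝ F)
  have hmom : ∀ n < l, |tsbI R (F * Polynomial.X ^ n)| ≤ K * (2 ^ n * √(n.factorial)) := by
    intro n hn
    have := tsb_mom L l K hK (fun r hr => h r hr) n 0 (by omega)
    simpa [L, tsbH_zero] using this
  have hfac : ∀ m n : ℕ, m ≤ n → √(m.factorial : ℝ) ≤ √(n.factorial) := by
    intro m n hmn
    apply sqrt_le_sqrt
    exact_mod_cast Nat.factorial_le hmn
  have hexp : ∀ (G : Polynomial ℝ) (d : ℕ), G.degree < d →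
      |tsbI R (F * G)| ≤ ∑ n ∈ range d, |G.coeff n| * |tsbI R (F * Polynomial.X ^ n)| := by
    intro G d hd
    have e : F * G = ∑ n ∈ range d, G.coeff n • (F * Polynomial.X ^ n) := by
      have e0 : G = ∑ n ∈ range d, Polynomial.C (G.coeff n) * Polynomial.X ^ n := by
        ext m
        rw [Polynomial.finsetSum_coeff]
        simp only [Polynomial.coeff_C_mul_X_pow, sum_ite_eq, mem_range]
        split_ifs with hm
        · rfl
        · exact (Polynomial.degree_lt_iff_coeff_zero _ _).mp hd m (by omega)
      conv_lhs => rw [e0, mul_sum]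
      refine sum_congr rfl fun n _ => ?_
      rw [Polynomial.smul_eq_C_mul]; ring
    rw [e, map_sum]
    refine (abs_sum_le_sum_abs _ _).trans (le_of_eq ?_)
    refine sum_congr rfl fun n _ => ?_
    rw [map_smul, smul_eq_mul, abs_mul]
  have hcard : ∀ d : ℕ, (d:ℝ) ≤ 2 ^ d := fun d => by
    exact_mod_cast (Nat.lt_two_pow_self (n := d)).le
  -- bound on N
  have hNb : N ≤ K * E * (12 * ρ) ^ l * √(l.factorial) := by
    have h1 : N * N ≤ (K * E * (12 * ρ) ^ l * √(l.factorial)) * N := by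
      rw [hN, mul_self_sqrt (tsbI_sq_nonneg R F), ← hN]
      calc _ ≤ |tsbI R (F * F)| := le_abs_self _
        _ ≤ _ := hexp F l hF
        _ ≤ ∑ n ∈ range l, 3 ^ l * (E * N) * (K * (2 ^ l * √(l.factorial))) * ρ ^ l := by
          refine sum_le_sum fun n hn => ?_
          have hn := mem_range.mp hn
          have c1 := tsbI_coeff R hR l F hF n
          have c2 := hmom n hn
          rw [← hE, ← hN] at c1
          have c3 : |F.coeff n| ≤ 3 ^ l * (E * N) * ρ ^ l := by
            have : |F.coeff n| = |F.coeff n| * R ^ n * R⁻¹ ^ n := by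
              rw [mul_assoc, ← mul_pow, mul_inv_cancel₀ hR.ne', one_pow, mul_one]
            rw [this]
            apply mul_le_mul c1 _ (by positivity) (by positivity)
            calc R⁻¹ ^ n ≤ ρ ^ n := by gcongr; exact le_max_right _ _
              _ ≤ ρ ^ l := pow_le_pow_right₀ hρ1 hn.le
          have c4 : |tsbI R (F * Polynomial.X ^ n)| ≤ K * (2 ^ l * √(l.factorial)) := by
            refine c2.trans ?_
            have := hfac n l hn.le
            gcongr
            · norm_num
          calc _ ≤ (3 ^ l * (E * N) * ρ ^ l) * (K * (2 ^ l * √(l.factorial))) :=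
                mul_le_mul c3 c4 (abs_nonneg _) (by positivity)
            _ = _ := by ring
        _ = l * (3 ^ l * (E * N) * (K * (2 ^ l * √(l.factorial))) * ρ ^ l) := by
          rw [sum_const, card_range, nsmul_eq_mul]
        _ ≤ 2 ^ l * (3 ^ l * (E * N) * (K * (2 ^ l * √(l.factorial))) * ρ ^ l) := by
          gcongr; exact hcard l
        _ = _ := by
          have : (12:ℝ) ^ l = 2 ^ l * 3 ^ l * 2 ^ l := by rw [← mul_pow, ← mul_pow]; norm_num
          rw [mul_pow, this]; ring
    rcases hN0.eq_or_lt with h0 | h0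
    · rw [← h0]; positivity
    · exact le_of_mul_le_mul_right h1 h0
  have hdeg : (tsbH j).degree < ((j+1 : ℕ) : WithBot ℕ) := by
    rw [Polynomial.degree_lt_iff_coeff_zero]
    intro m hm
    simp [tsbH, Polynomial.coeff_hermite_of_lt (by omega : j < m)]
  have hterm : ∀ n ∈ range (j+1), |(tsbH j).coeff n| * |tsbI R (F * Polynomial.X ^ n)| ≤
      2 ^ j * √(j.factorial) * (K * (1 + E * √(2 * R))) * (12 * ρ * σ) ^ j := by
    intro n hn
    have hn := mem_range.mp hn
    have hb := tsbH_coeff j n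
    have hnpos : 0 < √(n.factorial : ℝ) := sqrt_pos.mpr (by exact_mod_cast n.factorial_pos)
    have hb2 : |tsbI R (F * Polynomial.X ^ n)| ≤
        K * (1 + E * √(2 * R)) * (12 * ρ * σ) ^ j * √(n.factorial) := by
      have hB1 : 1 ≤ 12 * ρ * σ := by nlinarith
      rcases lt_or_ge n l with hl | hl
      · refine (hmom n hl).trans ?_
        have : (2:ℝ) ^ n ≤ (12 * ρ * σ) ^ j := by
          calc (2:ℝ) ^ n ≤ (12 * ρ * σ) ^ n := by gcongr; nlinarith
            _ ≤ _ := pow_le_pow_right₀ hB1 (by omega)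
        calc _ = K * 1 * 2 ^ n * √(n.factorial) := by ring
          _ ≤ _ := by
            gcongr
            have : 0 ≤ E * √(2*R) := by positivity
            linarith
      · have c1 := tsbI_cs R F (Polynomial.X ^ n)
        rw [← hN] at c1
        refine c1.trans ?_
        have c2 := tsbI_pow R hR n
        calc _ ≤ (K * E * (12 * ρ) ^ l * √(l.factorial)) * (√(2 * R) * R ^ n) := by gcongr
          _ ≤ (K * E * (12 * ρ) ^ j * √(n.factorial)) * (√(2 * R) * σ ^ j) := by
            have : R ^ n ≤ σ ^ j := by
              calc R ^ n ≤ σ ^ n := by gcongr; exact le_max_right _ _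
                _ ≤ _ := pow_le_pow_right₀ hσ1 (by omega)
            have h3 := hfac l n hl
            have h4 : (12 * ρ) ^ l ≤ (12 * ρ) ^ j := pow_le_pow_right₀ (by linarith) hj
            gcongr
          _ = K * (E * √(2 * R)) * (12 * ρ * σ) ^ j * √(n.factorial) := by
            rw [mul_pow (12 * ρ)]; ring
          _ ≤ _ := by gcongr; linarith
    calc _ ≤ |(tsbH j).coeff n| * (K * (1 + E * √(2 * R)) * (12 * ρ * σ) ^ j * √(n.factorial)) := by
          gcongr
      _ = (|(tsbH j).coeff n| * √(n.factorial)) * (K * (1 + E * √(2 * R)) * (12 * ρ * σ) ^ j) := by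
          ring
      _ ≤ (2 ^ j * √(j.factorial)) * (K * (1 + E * √(2 * R)) * (12 * ρ * σ) ^ j) := by
          gcongr
      _ = _ := by ring
  calc _ ≤ _ := hexp _ _ hdeg
    _ ≤ _ := sum_le_sum hterm
    _ = ((j+1:ℕ):ℝ) * (2 ^ j * √(j.factorial) * (K * (1 + E * √(2 * R))) * (12 * ρ * σ) ^ j) := by
      rw [sum_const, card_range, nsmul_eq_mul]
    _ ≤ 2 ^ j * (2 ^ j * √(j.factorial) * (K * (1 + E * √(2 * R))) * (12 * ρ * σ) ^ j) := by
      gcongr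
      exact_mod_cast (Nat.lt_two_pow_self (n := j))
    _ = _ := by
      have : (48:ℝ) ^ j = 2 ^ j * 2 ^ j * 12 ^ j := by rw [← mul_pow, ← mul_pow]; norm_num
      simp only [mul_pow, this]; ring

lemma tsb_asym (A B : ℝ) (hA : 0 < A) (hB : 0 < B) : ∃ δ₀ : ℝ, 0 < δ₀ ∧
    ∀ δ : ℝ, 0 < δ → δ < δ₀ → ∀ l : ℕ, 8 * log (1 / δ) / log (log (1 / δ)) ≤ l →
      A * (B ^ l / √(l.factorial)) ≤ δ := by
  set Q := 8 * (|log A| + |log B| + 1) with hQ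
  refine ⟨exp (-exp Q), exp_pos _, ?_⟩
  intro δ hδ hδ0 l hl
  set L := log (1 / δ) with hL
  have hLδ : log δ = -L := by rw [hL, one_div, log_inv, neg_neg]
  have hLQ : exp Q < L := by
    have := log_lt_log hδ hδ0
    rw [log_exp, hLδ] at this
    linarith
  have hL0 : 0 < L := (exp_pos _).trans hLQ
  have hlogL : Q < log L := by
    have := log_lt_log (exp_pos _) hLQ
    rwa [log_exp] at this
  have hQ0 : 0 < Q := by positivity
  have hlogL0 : 0 < log L := hQ0.trans hlogL
  have h1 : 8 * L ≤ l * log L := by rwa [div_le_iff₀ hlogL0] at hl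
  have hsL : 0 < √L := sqrt_pos.mpr hL0
  have hls : log L ≤ 2 * √L := by
    have := log_le_sub_one_of_pos hsL
    rw [log_sqrt hL0.le] at this
    linarith
  have hl2 : √L ≤ l := by
    by_contra hcon
    push Not at hcon
    have : (l:ℝ) * log L ≤ √L * (2 * √L) := by gcongr
    nlinarith [mul_self_sqrt hL0.le]
  have hlpos : (0:ℝ) < l := hsL.trans_le hl2
  have hl0 : l ≠ 0 := by rintro rfl; simp at hlpos
  have hl1 : (1:ℝ) ≤ l := by exact_mod_cast Nat.one_le_iff_ne_zero.mpr hl0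
  have hlogl : log L / 2 ≤ log l := by
    rw [← log_sqrt hL0.le]; exact log_le_log hsL hl2
  have hst := Stirling.le_log_factorial_stirling hl0
  have hst2 : l * log l - l ≤ log (l.factorial) := by
    have : 0 ≤ log l := log_nonneg hl1
    have : 0 ≤ log (2 * π) := log_nonneg (by have := pi_gt_three; linarith)
    linarith
  have hfpos : (0:ℝ) < l.factorial := by exact_mod_cast l.factorial_pos
  rw [← log_le_log_iff (by positivity) hδ, hLδ, log_mul (by positivity) (by positivity),
    log_div (by positivity) (by positivity), log_pow, log_sqrt hfpos.le]
  have e1 : 4 * L ≤ l * log l := by nlinarith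
  have e2 : l * (4 * (|log A| + |log B| + 1)) ≤ l * log l := by
    gcongr; linarith
  have e3 : log A ≤ l * |log A| := by nlinarith [le_abs_self (log A), abs_nonneg (log A)]
  have e4 : l * log B ≤ l * |log B| := by gcongr; exact le_abs_self _
  nlinarith

lemma tsb_summable (D : ℝ) : Summable (fun j : ℕ => D ^ j / √(j.factorial)) := by
  have h1 := Real.summable_pow_div_factorial (4 * D ^ 2)
  have h2 : Summable (fun j : ℕ => ((1/4 : ℝ)) ^ j) :=
    summable_geometric_of_lt_one (by norm_num) (by norm_num)
  refine Summable.of_norm_bounded (h1.add h2) fun j => ?_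
  have hf : (0:ℝ) < j.factorial := by exact_mod_cast j.factorial_pos
  have hs : 0 < √(j.factorial : ℝ) := sqrt_pos.mpr hf
  rw [norm_eq_abs]
  set x := 2 ^ j * (D ^ j / √(j.factorial)) with hx
  set y : ℝ := (1/2) ^ j with hy
  have hxy : D ^ j / √(j.factorial) = x * y := by
    rw [hx, hy]
    have : (2:ℝ) ^ j * (1/2)^j = 1 := by rw [← mul_pow]; norm_num
    linear_combination (-(D ^ j / √(j.factorial))) * this
  have hx2 : (4 * D ^ 2) ^ j / j.factorial = x ^ 2 := by
    have h4 : (4:ℝ) ^ j = (2 ^ j) ^ 2 := by rw [← pow_mul, mul_comm, pow_mul]; norm_num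
    have h5 : (D ^ 2) ^ j = (D ^ j) ^ 2 := by rw [← pow_mul, ← pow_mul, mul_comm]
    rw [hx, mul_pow 4, h4, h5, mul_pow (2 ^ j), div_pow, sq_sqrt hf.le]
    ring
  have hy2 : (1/4 : ℝ) ^ j = y ^ 2 := by
    rw [hy, ← pow_mul, mul_comm, pow_mul]; norm_num
  rw [hxy, hx2, hy2, abs_le]
  constructor <;> nlinarith [sq_nonneg (x + y), sq_nonneg (x - y), sq_nonneg x, sq_nonneg y]

lemma tsb_hermiteR (j : ℕ) (x : ℝ) : hermiteR j x = (tsbH j).eval x := by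
  rw [hermiteR, tsbH, Polynomial.aeval_def, Polynomial.eval₂_eq_eval_map]; rfl

lemma tsb_Jint_poly (R : ℝ) (p : Polynomial ℝ) (j : ℕ) :
    Jint R (fun x => p.eval x) j = 1 / (√(2 * π) * j.factorial) * tsbI R (p * tsbH j) := by
  rw [Jint, tsbI_apply, ← integral_const_mul]
  congr 1
  funext x
  rw [tsb_hermiteR, Polynomial.eval_mul]; ring

lemma tsb_V (R : ℝ) (l : ℕ) (β : Fin l → ℝ) (r : Fin l) :
    (Vmat R l *ᵥ β) r = 1 / (√(2 * π) * (r:ℕ).factorial) *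
      tsbI R ((∑ a : Fin l, Polynomial.C (β a) * tsbH a) * tsbH r) := by
  rw [sum_mul, map_sum, mul_sum, Matrix.mulVec, dotProduct]
  refine sum_congr rfl fun c _ => ?_
  have e : (hermiteR c) = fun x => (tsbH c).eval x := funext fun x => tsb_hermiteR c x
  rw [Vmat, Matrix.of_apply, e, tsb_Jint_poly, mul_assoc (Polynomial.C _), ← Polynomial.smul_eq_C_mul, map_smul, smul_eq_mul]
  ring

lemma tsb_Jbound (R : ℝ) (hR : 0 < R) (l i : ℕ) (hi : i < l) (j : ℕ) (hj : l ≤ j) :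
    |Jint R (fun x => ∑ a : Fin l,
      ((Vmat R l)⁻¹ *ᵥ Pi.single (⟨i, hi⟩ : Fin l) (1 : ℝ)) a * hermiteR a x) j| ≤
    (i.factorial * (1 + √(R⁻¹ * exp (R ^ 2 / 2)) * √(2 * R))) *
        ((48 * max 1 R⁻¹ * max 1 R) ^ j / √(j.factorial)) := by
  set β := (Vmat R l)⁻¹ *ᵥ Pi.single (⟨i, hi⟩ : Fin l) (1 : ℝ) with hβ
  set F : Polynomial ℝ := ∑ a : Fin l, Polynomial.C (β a) * tsbH a with hFdef
  have hs : 0 < √(2 * π) := sqrt_pos.mpr (by positivity)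
  have e : (fun x => ∑ a : Fin l, β a * hermiteR a x) = fun x => F.eval x := by
    funext x
    rw [hFdef, Polynomial.eval_finsetSum]
    simp [tsb_hermiteR]
  have hFd : F.degree < l := by
    rw [Polynomial.degree_lt_iff_coeff_zero]
    intro m hm
    rw [hFdef, Polynomial.finsetSum_coeff]
    refine sum_eq_zero fun a _ => ?_
    simp [tsbH, Polynomial.coeff_hermite_of_lt (by have := a.2; omega : (a:ℕ) < m)]
  have hV : ∀ r < l, |tsbI R (F * tsbH r)| ≤ √(2 * π) * i.factorial := by
    intro r hr
    have h1 := tsb_V R l β ⟨r, hr⟩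
    simp only [← hFdef] at h1
    have hf : (0:ℝ) < r.factorial := by exact_mod_cast r.factorial_pos
    have h2 : tsbI R (F * tsbH r) = √(2 * π) * r.factorial * (Vmat R l *ᵥ β) ⟨r, hr⟩ := by
      rw [h1]; field_simp
    rw [h2]
    by_cases hu : IsUnit (Vmat R l).det
    · have h3 : Vmat R l *ᵥ β = Pi.single (⟨i, hi⟩ : Fin l) (1 : ℝ) := by
        rw [hβ, Matrix.mulVec_mulVec, Matrix.mul_nonsing_inv _ hu, Matrix.one_mulVec]
      rw [h3]
      by_cases hri : r = i
      · subst hri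
        rw [Pi.single_eq_same, mul_one, abs_of_nonneg (by positivity)]
      · rw [Pi.single_eq_of_ne (by simpa using hri)]
        simp only [mul_zero, abs_zero]; positivity
    · have h3 : β = 0 := by
        rw [hβ, Matrix.nonsing_inv_apply_not_isUnit _ hu, Matrix.zero_mulVec]
      rw [h3]; simp; positivity
  have hc := tsb_core R hR l F hFd _ (by positivity) hV j hj
  rw [e, tsb_Jint_poly, abs_mul, abs_of_nonneg (by positivity)]
  have hf : (0:ℝ) < j.factorial := by exact_mod_cast j.factorial_pos
  have hsf : 0 < √(j.factorial : ℝ) := sqrt_pos.mpr hf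
  calc _ ≤ 1 / (√(2 * π) * j.factorial) * _ := mul_le_mul_of_nonneg_left hc (by positivity)
    _ = _ := by
      have : (j.factorial : ℝ) = √(j.factorial : ℝ) * √(j.factorial : ℝ) :=
        (mul_self_sqrt hf.le).symm
      rw [this]
      rw [sqrt_mul_self hsf.le]
      field_simp

/-- For every `R, M > 0` and `k ≥ 1` there exists `C > 0` (depending only on `R, M, k`) such
that for all sufficiently small `δ > 0` and every `ℓ` with `ℓ ≥ C·log(1/δ)/log log(1/δ)` and
`ℓ ≥ 2(2k-1)`: for each `1 ≤ i ≤ 2k-1`, the tail series `∑_{j≥ℓ} J_{fᵢ,j} m_j` converges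
absolutely and its sum is at most `δ` in absolute value, where `m_j = ∑_t w_t μ_t^j`,
`fᵢ = ∑_a (βᵢ)_a h_a` and `βᵢ = V⁻¹ eᵢ`. -/
theorem tail_series_bound (R M : ℝ) (hR : 0 < R) (hM : 0 < M) (k : ℕ) (hk : 1 ≤ k) :
    ∃ C : ℝ, 0 < C ∧ ∃ δ₀ : ℝ, 0 < δ₀ ∧
      ∀ δ : ℝ, 0 < δ → δ < δ₀ →
        ∀ ℓ : ℕ, C * Real.log (1 / δ) / Real.log (Real.log (1 / δ)) ≤ ℓ →
          2 * (2 * k - 1) ≤ ℓ →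
          ∀ (w μ : Fin k → ℝ), (∀ t, 0 < w t) → ∑ t, w t = 1 →
            (∀ t, μ t ∈ Set.Icc (-M) M) →
            ∀ i : ℕ, 1 ≤ i → i ≤ 2 * k - 1 → ∀ hi : i < ℓ,
              Summable (fun j : ℕ =>
                |Jint R
                    (fun x => ∑ a : Fin ℓ,
                      ((Vmat R ℓ)⁻¹ *ᵥ Pi.single (⟨i, hi⟩ : Fin ℓ) (1 : ℝ)) a * hermiteR a x)
                    (ℓ + j) *
                  (∑ t, w t * μ t ^ (ℓ + j))|) ∧
              |∑' j : ℕ,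
                  Jint R
                      (fun x => ∑ a : Fin ℓ,
                        ((Vmat R ℓ)⁻¹ *ᵥ Pi.single (⟨i, hi⟩ : Fin ℓ) (1 : ℝ)) a * hermiteR a x)
                      (ℓ + j) *
                    (∑ t, w t * μ t ^ (ℓ + j))| ≤ δ := by
  set B := 48 * max 1 R⁻¹ * max 1 R with hBdef
  have hB : 0 < B := by positivity
  set A := ((2 * k - 1).factorial : ℝ) * (1 + √(R⁻¹ * exp (R ^ 2 / 2)) * √(2 * R)) with hAdef
  have hA : 0 < A := by
    have : (0:ℝ) < (2 * k - 1).factorial := by exact_mod_cast Nat.factorial_pos _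
    positivity
  have hD : 0 < B * M := by positivity
  have hsum := tsb_summable (B * M)
  set S := ∑' j : ℕ, (B * M) ^ j / √(j.factorial) with hS
  have hS0 : 0 ≤ S := tsum_nonneg fun j => by positivity
  obtain ⟨δ₀, hδ₀, hmain⟩ := tsb_asym (A * (S + 1)) (B * M) (by positivity) hD
  refine ⟨8, by norm_num, δ₀, hδ₀, ?_⟩
  intro δ hδ hδδ ℓ hℓ _ w μ hw hw1 hμ i _ hik hi
  have hfin := hmain δ hδ hδδ ℓ hℓ
  have hm : ∀ n : ℕ, |∑ t, w t * μ t ^ n| ≤ M ^ n := by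
    intro n
    calc _ ≤ ∑ t, |w t * μ t ^ n| := abs_sum_le_sum_abs _ _
      _ ≤ ∑ t, w t * M ^ n := by
        refine sum_le_sum fun t _ => ?_
        rw [abs_mul, abs_of_pos (hw t), abs_pow]
        have := (hw t).le
        have := abs_le.mpr (hμ t)
        gcongr
      _ = M ^ n := by rw [← sum_mul, hw1, one_mul]
  have hterm : ∀ j : ℕ, |Jint R
                    (fun x => ∑ a : Fin ℓ,
                      ((Vmat R ℓ)⁻¹ *ᵥ Pi.single (⟨i, hi⟩ : Fin ℓ) (1 : ℝ)) a * hermiteR a x)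
                    (ℓ + j) *
                  (∑ t, w t * μ t ^ (ℓ + j))| ≤
      A * ((B * M) ^ ℓ / √(ℓ.factorial)) * ((B * M) ^ j / √(j.factorial)) := by
    intro j
    have h1 := tsb_Jbound R hR ℓ i hi (ℓ + j) (by omega)
    rw [← hBdef] at h1
    have hfi : (i.factorial : ℝ) ≤ (2 * k - 1).factorial := by
      exact_mod_cast Nat.factorial_le hik
    have hff : √(ℓ.factorial : ℝ) * √(j.factorial) ≤ √((ℓ + j).factorial) := by
      rw [← sqrt_mul (by positivity)]
      apply sqrt_le_sqrt
      exact_mod_cast Nat.le_of_dvd (Nat.factorial_pos _) (Nat.factorial_mul_factorial_dvd_factorial_add ℓ j)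
    have p1 : 0 < √(ℓ.factorial : ℝ) := sqrt_pos.mpr (by exact_mod_cast Nat.factorial_pos _)
    have p2 : 0 < √(j.factorial : ℝ) := sqrt_pos.mpr (by exact_mod_cast Nat.factorial_pos _)
    rw [abs_mul]
    calc _ ≤ (A * (B ^ (ℓ + j) / (√(ℓ.factorial : ℝ) * √(j.factorial)))) * M ^ (ℓ + j) := by
          apply mul_le_mul _ (hm _) (abs_nonneg _) (by positivity)
          refine h1.trans ?_
          rw [hAdef]
          gcongr
      _ = _ := by
        rw [pow_add, pow_add, mul_pow B M, mul_pow B M]; field_simp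
  have hs2 := hsum.mul_left (A * ((B * M) ^ ℓ / √(ℓ.factorial)))
  have hs1 : Summable (fun j : ℕ =>
                |Jint R
                    (fun x => ∑ a : Fin ℓ,
                      ((Vmat R ℓ)⁻¹ *ᵥ Pi.single (⟨i, hi⟩ : Fin ℓ) (1 : ℝ)) a * hermiteR a x)
                    (ℓ + j) *
                  (∑ t, w t * μ t ^ (ℓ + j))|) :=
    Summable.of_nonneg_of_le (fun _ => abs_nonneg _) hterm hs2
  refine ⟨hs1, ?_⟩
  have h3 := tsum_of_norm_bounded (f := fun j : ℕ => Jint R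
                    (fun x => ∑ a : Fin ℓ,
                      ((Vmat R ℓ)⁻¹ *ᵥ Pi.single (⟨i, hi⟩ : Fin ℓ) (1 : ℝ)) a * hermiteR a x)
                    (ℓ + j) *
                  (∑ t, w t * μ t ^ (ℓ + j))) hs2.hasSum hterm
  rw [norm_eq_abs, tsum_mul_left, ← hS] at h3
  refine h3.trans (le_trans ?_ hfin)
  have : 0 ≤ A * ((B * M) ^ ℓ / √(ℓ.factorial)) := by positivity
  nlinarith
end

section
/- For every R > 0, M > 0 and integer k ≥ 1 there exists a constant C > 0 (depending only on R and M) such that for all integers ℓ ≥ 2(2k−1), 1 ≤ i ≤ 2k−1, and n ≥ 1 the following holds. Let w_1, …, w_k > 0 with Σ_t w_t = 1 and μ_1, …, μ_k ∈ [−M, M], and let X_1, …, X_n be i.i.d. samples from the censored model with parameters (w_t, μ_t). Define f̂_i : Option ℝ → ℝ by f̂_i(x) = f_i(x) if x is a real value and f̂_i(FAIL) = 0, where f_i := Σ_{a=0}^{ℓ−1} (β_i)_a · h_a and β_i := V^{−1} e_i. Then the estimator m̂_i := (1/n) Σ_{s=1}^n f̂_i(X_s) satisfies Var(m̂_i) ≤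 (1/n) · 2^{C · ℓ · log ℓ}. -/
open MeasureTheory Real Finset Matrix

/-- Borel-style measurable space on `Option ℝ`: `Option α` is identified with `α ⊕ PUnit`. -/
instance {α : Type} [MeasurableSpace α] : MeasurableSpace (Option α) :=
  MeasurableSpace.map (Equiv.optionEquivSumPUnit.{0} α).symm inferInstance

/-- The density of the normal distribution `N(μ, 1)`. -/
noncomputable def gaussd (μ x : ℝ) : ℝ := (1 / Real.sqrt (2 * π)) * Real.exp (-(x - μ) ^ 2 / 2)

/-- The censored model on `Option ℝ`: its restriction to `ℝ` (embedded via `some`) has density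
`∑_t w_t g_{μ_t}(x) · 1_{x ∈ [-R,R]}` with respect to Lebesgue measure, and the remaining mass
`1 - ∑_t w_t ∫_{[-R,R]} g_{μ_t}` is placed on `FAIL` (encoded as `none`). -/
noncomputable def censored (R : ℝ) (k : ℕ) (w μ : Fin k → ℝ) : Measure (Option ℝ) :=
  Measure.map Option.some
      (volume.withDensity fun x =>
        ENNReal.ofReal ((Set.Icc (-R) R).indicator (fun y => ∑ t, w t * gaussd (μ t) y) x))
    + (1 - ENNReal.ofReal (∫ x in Set.Icc (-R) R, ∑ t, w t * gaussd (μ t) x)) •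
        Measure.dirac (none : Option ℝ)


noncomputable def HP (a : ℕ) : Polynomial ℝ := (Polynomial.hermite a).map (Int.castRingHom ℝ)

lemma hermiteR_eq (a : ℕ) (x : ℝ) : hermiteR a x = (HP a).eval x := by
  simp [hermiteR, HP, Polynomial.eval_map, Polynomial.aeval_def]

lemma hermite_deriv (n : ℕ) : Polynomial.derivative (Polynomial.hermite (n + 1))
    = (n + 1 : Polynomial ℤ) * Polynomial.hermite n := by
  induction n with
  | zero => simp
  | succ n ih =>
    rw [Polynomial.hermite_succ (n + 1)]
    simp only [Polynomial.derivative_sub, Polynomial.derivative_mul, Polynomial.derivative_X, ih]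
    rw [Polynomial.hermite_succ n]
    simp
    ring

lemma HP_zero : HP 0 = 1 := by simp [HP]

lemma HP_X_zero : Polynomial.X * HP 0 = HP 1 := by simp [HP]

lemma HP_X_succ (a : ℕ) : Polynomial.X * HP (a + 1) = HP (a + 2) + Polynomial.C (a + 1 : ℝ) * HP a := by
  have h := Polynomial.hermite_succ (a + 1)
  rw [hermite_deriv] at h
  have h2 := congrArg (Polynomial.map (Int.castRingHom ℝ)) h
  simp only [Polynomial.map_sub, Polynomial.map_mul, Polynomial.map_X, Polynomial.map_add,
    Polynomial.map_natCast, Polynomial.map_one] at h2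
  simp only [HP]
  rw [show a + 1 + 1 = a + 2 from rfl] at h2
  rw [h2]
  simp

lemma HP_degree (a : ℕ) : (HP a).degree = a := by
  rw [HP, (Polynomial.hermite_monic a).degree_map, Polynomial.degree_hermite]

lemma functional_bound (L : Polynomial ℝ →ₗ[ℝ] ℝ) (ℓ : ℕ) (B : ℝ) (hB : 0 ≤ B)
    (hL : ∀ r, r < ℓ → |L (HP r)| ≤ B) (m : ℕ) :
    ∀ a, m + a < ℓ → |L (Polynomial.X ^ m * HP a)| ≤ B * (ℓ : ℝ) ^ m := by
  induction m with
  | zero => intro a ha; simpa using hL a (by omega)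
  | succ m ih =>
    intro a ha
    have hl : (1 : ℝ) ≤ ℓ := by exact_mod_cast (by omega : 1 ≤ ℓ)
    have hP : 0 ≤ B * (ℓ : ℝ) ^ m := by positivity
    cases a with
    | zero =>
      rw [pow_succ, mul_assoc, HP_X_zero]
      refine (ih 1 (by omega)).trans ?_
      rw [pow_succ, ← mul_assoc]
      nlinarith
    | succ a =>
      rw [pow_succ, mul_assoc, HP_X_succ, mul_add, map_add,
        show Polynomial.X ^ m * (Polynomial.C (a + 1 : ℝ) * HP a)
          = (a + 1 : ℝ) • (Polynomial.X ^ m * HP a) by rw [Polynomial.smul_eq_C_mul]; ring, map_smul]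
      have h1 := ih (a + 2) (by omega)
      have h2 := ih a (by omega)
      have h3 : ((a : ℝ) + 2) ≤ ℓ := by exact_mod_cast (by omega : a + 2 ≤ ℓ)
      refine (abs_add_le _ _).trans ?_
      rw [smul_eq_mul, abs_mul, abs_of_nonneg (by positivity : (0 : ℝ) ≤ a + 1), pow_succ,
        ← mul_assoc]
      nlinarith [mul_le_mul_of_nonneg_left h2 (by positivity : (0 : ℝ) ≤ a + 1)]

lemma coeff_prod_bound {ι : Type*} [DecidableEq ι] (s : Finset ι) (c y : ι → ℝ) (D R : ℝ)
    (hD : 0 ≤ D) (hR : 0 ≤ R)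
    (hc : ∀ j ∈ s, |c j| ≤ D) (hy : ∀ j ∈ s, |y j| ≤ R) :
    ∀ m, |(∏ j ∈ s, (Polynomial.C (c j) * (Polynomial.X - Polynomial.C (y j)))).coeff m|
      ≤ (D * (1 + R)) ^ s.card := by
  induction s using Finset.induction_on with
  | empty => intro m; simp [Polynomial.coeff_one]; split_ifs <;> simp
  | insert j s hj ih =>
    intro m
    have ih' := ih (fun j hj => hc j (Finset.mem_insert_of_mem hj))
      (fun j hj => hy j (Finset.mem_insert_of_mem hj))
    rw [Finset.prod_insert hj, Finset.card_insert_of_notMem hj, mul_assoc, Polynomial.coeff_C_mul,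
      sub_mul, Polynomial.coeff_sub, Polynomial.coeff_C_mul]
    set q := ∏ j ∈ s, (Polynomial.C (c j) * (Polynomial.X - Polynomial.C (y j)))
    have hP : 0 ≤ (D * (1 + R)) ^ s.card := by positivity
    have h1 : |(Polynomial.X * q).coeff m| ≤ (D * (1 + R)) ^ s.card := by
      cases m with
      | zero => simpa using hP
      | succ m => rw [Polynomial.coeff_X_mul]; exact ih' m
    have h2 : |y j * q.coeff m| ≤ R * (D * (1 + R)) ^ s.card := by
      rw [abs_mul]
      exact mul_le_mul (hy j (by simp)) (ih' m) (abs_nonneg _) hR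
    rw [abs_mul, pow_succ]
    calc |c j| * |(Polynomial.X * q).coeff m - y j * q.coeff m|
        ≤ D * ((D * (1 + R)) ^ s.card + R * (D * (1 + R)) ^ s.card) :=
          mul_le_mul (hc j (by simp)) ((abs_sub _ _).trans (add_le_add h1 h2)) (abs_nonneg _) hD
      _ = _ := by ring

lemma interp_bound (R : ℝ) (hR : 0 < R) (ℓ : ℕ) (hl : 1 ≤ ℓ) (F : Polynomial ℝ)
    (hF : F.degree < (ℓ + 1 : ℕ)) (I : ℝ) (hI : ∀ y ∈ Set.Icc (-R) R, |F.eval y| ≤ I) (m : ℕ) :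
    |F.coeff m| ≤ (ℓ + 1) * (I * ((ℓ / (2 * R)) * (1 + R)) ^ ℓ) := by
  have hl' : (1 : ℝ) ≤ ℓ := by exact_mod_cast hl
  set v : ℕ → ℝ := fun j => -R + 2 * R * j / ℓ with hv
  have hvd : ∀ a b, v a - v b = (2 * R / ℓ) * ((a : ℝ) - b) := by
    intro a b; simp only [hv]; ring
  have hinj : Set.InjOn v (Finset.range (ℓ + 1) : Finset ℕ) := by
    intro a _ b _ h
    have h2 := hvd a b
    rw [h, sub_self] at h2
    have : (2 * R / ℓ) ≠ 0 := by positivity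
    have := (mul_eq_zero.mp h2.symm).resolve_left this
    exact_mod_cast sub_eq_zero.mp this
  have hmem : ∀ j ∈ Finset.range (ℓ + 1), v j ∈ Set.Icc (-R) R := by
    intro j hj
    have : (j : ℝ) ≤ ℓ := by exact_mod_cast (by simpa [Nat.lt_succ_iff] using hj)
    constructor
    · simp only [hv]; have : 0 ≤ 2 * R * j / ℓ := by positivity
      linarith
    · simp only [hv]
      have : 2 * R * j / ℓ ≤ 2 * R := by
        rw [div_le_iff₀ (by positivity)]; nlinarith
      linarith
  have hI0 : 0 ≤ I := (abs_nonneg _).trans (hI 0 (by simp [hR.le]))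
  have h := Lagrange.eq_interpolate (f := F) (s := Finset.range (ℓ + 1)) hinj (by simpa using hF)
  rw [h, Lagrange.interpolate_apply, Polynomial.finsetSum_coeff]
  refine (Finset.abs_sum_le_sum_abs _ _).trans ?_
  refine (Finset.sum_le_card_nsmul _ _ (I * ((ℓ / (2 * R)) * (1 + R)) ^ ℓ) ?_).trans ?_
  · intro j hj
    rw [Polynomial.coeff_C_mul, abs_mul]
    refine mul_le_mul (hI _ (hmem j hj)) ?_ (abs_nonneg _) hI0
    have := coeff_prod_bound ((Finset.range (ℓ + 1)).erase j) (fun l => (v j - v l)⁻¹) v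
      (ℓ / (2 * R)) R (by positivity) hR.le ?_ ?_ m
    · rw [Finset.card_erase_of_mem hj, Finset.card_range] at this
      simpa [Lagrange.basis, Lagrange.basisDivisor] using this
    · intro l hl2
      have hne : l ≠ j := (Finset.mem_erase.mp hl2).1
      have h1 : (1 : ℝ) ≤ |(j : ℝ) - l| := by
        have : (1 : ℤ) ≤ |(j : ℤ) - l| := Int.one_le_abs (by omega)
        exact_mod_cast this
      rw [hvd, abs_inv, abs_mul, abs_of_nonneg (by positivity : 0 ≤ 2 * R / ℓ), mul_inv, inv_div]
      have : |(j : ℝ) - l|⁻¹ ≤ 1 := inv_le_one_of_one_le₀ h1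
      exact mul_le_of_le_one_right (by positivity) this
    · intro l hl2
      exact abs_le.mpr (hmem l (Finset.mem_of_mem_erase hl2))
  · simp

lemma measurable_some' : Measurable (Option.some : ℝ → Option ℝ) := by
  have h : Measurable (Equiv.optionEquivSumPUnit.{0} ℝ).symm := by
    rw [measurable_iff_le_map]
    exact le_rfl
  exact h.comp measurable_inl

lemma measurable_elim' (f : ℝ → ℝ) (hf : Measurable f) :
    Measurable (fun o : Option ℝ => o.elim 0 f) := by
  intro s hs
  change MeasurableSet ((Equiv.optionEquivSumPUnit.{0} ℝ).symm ⁻¹' ((fun o : Option ℝ => o.elim 0 f) ⁻¹' s))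
  have : Measurable (Sum.elim f (fun _ : PUnit.{1} => (0 : ℝ))) :=
    measurable_fun_sum hf measurable_const
  have h2 := this hs
  convert h2 using 1
  ext x
  cases x <;> simp

lemma measurable_gaussd (m : ℝ) : Continuous (gaussd m) := by
  unfold gaussd; fun_prop

lemma gaussd_nonneg (m x : ℝ) : 0 ≤ gaussd m x := by unfold gaussd; positivity

lemma gaussd_eq (m x : ℝ) : gaussd m x = ProbabilityTheory.gaussianPDFReal m 1 x := by
  simp [gaussd, ProbabilityTheory.gaussianPDFReal]

section
variable (R : ℝ) (k : ℕ) (w μ : Fin k → ℝ)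

lemma dens_cont : Continuous (fun y => ∑ t, w t * gaussd (μ t) y) := by
  have := fun t => measurable_gaussd (μ t)
  fun_prop

lemma dens_nonneg (hw : ∀ t, 0 < w t) (y : ℝ) : 0 ≤ ∑ t, w t * gaussd (μ t) y :=
  Finset.sum_nonneg fun t _ => mul_nonneg (hw t).le (gaussd_nonneg _ _)

lemma dens_int_le (hw : ∀ t, 0 < w t) (hs : ∑ t, w t = 1) :
    ∫ x in Set.Icc (-R) R, ∑ t, w t * gaussd (μ t) x ≤ 1 := by
  have hi : ∀ t, Integrable (fun x => w t * gaussd (μ t) x) := by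
    intro t
    simp_rw [gaussd_eq]
    exact (ProbabilityTheory.integrable_gaussianPDFReal _ _).const_mul _
  refine (setIntegral_le_integral (integrable_finsetSum _ fun t _ => hi t)
    (Filter.Eventually.of_forall (dens_nonneg k w μ hw))).trans ?_
  rw [integral_finsetSum _ fun t _ => hi t, ← hs]
  refine Finset.sum_le_sum fun t _ => ?_
  simp_rw [gaussd_eq]
  rw [integral_const_mul, ProbabilityTheory.integral_gaussianPDFReal_eq_one _ one_ne_zero, mul_one]

lemma dens_meas : Measurable (fun x =>
        ENNReal.ofReal ((Set.Icc (-R) R).indicator (fun y => ∑ t, w t * gaussd (μ t) y) x)) :=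
  ((dens_cont k w μ).measurable.indicator measurableSet_Icc).ennreal_ofReal

lemma censored_prob (hw : ∀ t, 0 < w t) (hs : ∑ t, w t = 1) :
    IsProbabilityMeasure (censored R k w μ) := by
  constructor
  have h1 : (volume.withDensity fun x =>
        ENNReal.ofReal ((Set.Icc (-R) R).indicator (fun y => ∑ t, w t * gaussd (μ t) y) x))
        Set.univ = ENNReal.ofReal (∫ x in Set.Icc (-R) R, ∑ t, w t * gaussd (μ t) x) := by
    rw [withDensity_apply _ MeasurableSet.univ, setLIntegral_univ,
      ← integral_indicator measurableSet_Icc, ofReal_integral_eq_lintegral_ofReal]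
    · exact (integrable_indicator_iff measurableSet_Icc).mpr
        (dens_cont k w μ).integrableOn_Icc
    · exact Filter.Eventually.of_forall fun x =>
        Set.indicator_nonneg (fun y _ => dens_nonneg k w μ hw y) x
  rw [censored, Measure.add_apply, Measure.map_apply measurable_some' MeasurableSet.univ,
    Set.preimage_univ, h1, Measure.smul_apply, measure_univ, smul_eq_mul, mul_one]
  exact add_tsub_cancel_of_le (by
    rw [← ENNReal.ofReal_one]; exact ENNReal.ofReal_le_ofReal (dens_int_le R k w μ hw hs))

lemma censored_integral (hw : ∀ t, 0 < w t) (g : ℝ → ℝ) (hg : Continuous g) :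
    Integrable (fun o : Option ℝ => o.elim 0 g) (censored R k w μ) ∧
    ∫ o, o.elim 0 g ∂(censored R k w μ)
      = ∫ x in Set.Icc (-R) R, (∑ t, w t * gaussd (μ t) x) * g x := by
  have hm := measurable_elim' g hg.measurable
  have hlt : ∀ᵐ x : ℝ, ENNReal.ofReal ((Set.Icc (-R) R).indicator (fun y => ∑ t, w t * gaussd (μ t) y) x) < ⊤ :=
    Filter.Eventually.of_forall fun x => ENNReal.ofReal_lt_top
  have heq : (fun x => (ENNReal.ofReal ((Set.Icc (-R) R).indicator (fun y => ∑ t, w t * gaussd (μ t) y) x)).toReal • g x) = (Set.Icc (-R) R).indicator (fun x => (∑ t, w t * gaussd (μ t) x) * g x) := by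
    ext x
    rw [ENNReal.toReal_ofReal (Set.indicator_nonneg (fun y _ => dens_nonneg k w μ hw y) x)]
    by_cases hx : x ∈ Set.Icc (-R) R
    · simp only [Set.indicator_of_mem hx, smul_eq_mul]
    · simp only [Set.indicator_of_notMem hx, smul_eq_mul, zero_mul]
  have hi1 : Integrable (fun o : Option ℝ => o.elim 0 g) (Measure.map Option.some
      (volume.withDensity fun x =>
        ENNReal.ofReal ((Set.Icc (-R) R).indicator (fun y => ∑ t, w t * gaussd (μ t) y) x))) := by
    rw [integrable_map_measure hm.aestronglyMeasurable measurable_some'.aemeasurable]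
    change Integrable g _
    rw [integrable_withDensity_iff_integrable_smul' (dens_meas R k w μ) hlt, heq]
    exact (integrable_indicator_iff measurableSet_Icc).mpr
      ((dens_cont k w μ).mul hg).integrableOn_Icc
  have hdi : Integrable (fun o : Option ℝ => o.elim 0 g) (Measure.dirac (none : Option ℝ)) := by
    refine ⟨hm.aestronglyMeasurable, ?_⟩
    rw [hasFiniteIntegral_def, lintegral_dirac' _ (by fun_prop)]
    simp
  have hi2 : Integrable (fun o : Option ℝ => o.elim 0 g) ((1 - ENNReal.ofReal (∫ x in Set.Icc (-R) R, ∑ t, w t * gaussd (μ t) x)) •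
        Measure.dirac (none : Option ℝ)) :=
    hdi.smul_measure (by exact ENNReal.sub_ne_top (by simp))
  refine ⟨hi1.add_measure hi2, ?_⟩
  rw [censored, integral_add_measure hi1 hi2, integral_smul_measure,
    integral_dirac' _ _ hm.stronglyMeasurable,
    integral_map measurable_some'.aemeasurable hm.aestronglyMeasurable]
  change ∫ x, g x ∂_ + _ = _
  rw [integral_withDensity_eq_integral_toReal_smul (dens_meas R k w μ) hlt, heq,
    integral_indicator measurableSet_Icc]
  simp

lemma var_bound (hw : ∀ t, 0 < w t) (hs : ∑ t, w t = 1) (f : ℝ → ℝ) (hf : Continuous f)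
    (n : ℕ) (hn : 1 ≤ n) :
    ProbabilityTheory.variance
                (fun xs : Fin n → Option ℝ =>
                  (1 / (n : ℝ)) * ∑ s : Fin n, (xs s).elim 0 f)
                (Measure.pi fun _ : Fin n => censored R k w μ) ≤
      (1 / (n : ℝ)) * ∫ x in Set.Icc (-R) R, (∑ t, w t * gaussd (μ t) x) * f x ^ 2 := by
  have := censored_prob R k w μ hw hs
  have hm := measurable_elim' f hf.measurable
  have hsq : (fun o : Option ℝ => (o.elim 0 f) ^ 2) = fun o => o.elim 0 (fun x => f x ^ 2) := by
    ext o; cases o <;> simp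
  obtain ⟨hI, hE⟩ := censored_integral R k w μ hw (fun x => f x ^ 2) (by fun_prop)
  have hL : MemLp (fun o : Option ℝ => o.elim 0 f) 2 (censored R k w μ) := by
    rw [memLp_two_iff_integrable_sq hm.aestronglyMeasurable, hsq]
    exact hI
  have hv := ProbabilityTheory.variance_sum_pi (ι := Fin n) (μ := fun _ => censored R k w μ)
    (X := fun _ o => o.elim 0 f) (fun _ => hL)
  have hn' : (0 : ℝ) < n := by exact_mod_cast hn
  rw [ProbabilityTheory.variance_const_mul]
  have e : (fun xs : Fin n → Option ℝ => ∑ s : Fin n, (xs s).elim 0 f)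
     = ∑ s : Fin n, fun xs : Fin n → Option ℝ => (xs s).elim 0 f := by ext; simp
  rw [e, hv, Finset.sum_const, Finset.card_univ, Fintype.card_fin, nsmul_eq_mul, ← hE]
  have h3 := ProbabilityTheory.variance_le_expectation_sq (μ := censored R k w μ)
    hm.aestronglyMeasurable
  have h4 : ∫ o, ((fun o : Option ℝ => o.elim 0 f) ^ 2) o ∂(censored R k w μ) = ∫ o, o.elim 0 (fun x => f x ^ 2) ∂(censored R k w μ) := by
    rw [← hsq]; rfl
  rw [h4] at h3
  calc _ = (1 / (n : ℝ)) * ProbabilityTheory.variance (fun o : Option ℝ => o.elim 0 f) (censored R k w μ) := by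
        field_simp
    _ ≤ _ := mul_le_mul_of_nonneg_left h3 (by positivity)

end

noncomputable def Lfun (R : ℝ) (p : Polynomial ℝ) : Polynomial ℝ →ₗ[ℝ] ℝ where
  toFun q := ∫ x in Set.Icc (-R) R, (p.eval x * gaussd 0 x) * q.eval x
  map_add' q r := by
    have := measurable_gaussd 0
    simp only [Polynomial.eval_add, mul_add]
    refine integral_add (Continuous.integrableOn_Icc ?_) (Continuous.integrableOn_Icc ?_) <;>
      fun_prop
  map_smul' c q := by
    simp only [Polynomial.eval_smul, smul_eq_mul, RingHom.id_apply]
    rw [← integral_const_mul]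
    congr 1; ext x; ring

lemma exists_antideriv (p : Polynomial ℝ) (ℓ : ℕ) (hp : p.degree < ℓ) :
    ∃ F : Polynomial ℝ, F.degree < (ℓ + 1 : ℕ) ∧ F.derivative = p := by
  refine ⟨∑ m ∈ Finset.range ℓ, Polynomial.C (p.coeff m / (m + 1)) * Polynomial.X ^ (m + 1), ?_, ?_⟩
  · rw [Polynomial.degree_lt_iff_coeff_zero]
    intro j hj
    rw [Polynomial.finsetSum_coeff]
    refine Finset.sum_eq_zero fun m hm => ?_
    rw [Polynomial.coeff_C_mul, Polynomial.coeff_X_pow, if_neg, mul_zero]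
    have := Finset.mem_range.mp hm
    omega
  · rw [Polynomial.derivative_sum]
    ext j
    rw [Polynomial.finsetSum_coeff]
    simp only [Polynomial.derivative_C_mul_X_pow, Polynomial.coeff_C_mul, Polynomial.coeff_X_pow,
      Nat.add_sub_cancel]
    rw [Polynomial.degree_lt_iff_coeff_zero] at hp
    by_cases hj : j < ℓ
    · rw [Finset.sum_eq_single j]
      · simp; field_simp
      · intro b _ hb; rw [if_neg (Ne.symm hb), mul_zero]
      · intro h; exact absurd (Finset.mem_range.mpr hj) h
    · rw [hp j (by omega)]
      refine Finset.sum_eq_zero fun m hm => ?_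
      have := Finset.mem_range.mp hm
      rw [if_neg (by omega), mul_zero]

lemma coeff_le_L1 (R : ℝ) (hR : 0 < R) (ℓ : ℕ) (hl : 1 ≤ ℓ) (p : Polynomial ℝ)
    (hp : p.degree < ℓ) (m : ℕ) (hm : m < ℓ) :
    |p.coeff m| ≤ ℓ * ((ℓ + 1) * ((∫ x in Set.Icc (-R) R, |p.eval x|) *
      ((ℓ / (2 * R)) * (1 + R)) ^ ℓ)) := by
  obtain ⟨F, hFd, hF⟩ := exists_antideriv p ℓ hp
  set G := F - Polynomial.C (F.eval (-R)) with hG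
  have hGd : G.degree < (ℓ + 1 : ℕ) := by
    refine (Polynomial.degree_sub_le _ _).trans_lt (max_lt hFd ?_)
    exact Polynomial.degree_C_le.trans_lt (by exact_mod_cast Nat.succ_pos ℓ)
  have hGp : G.derivative = p := by simp [hG, hF]
  have hb : ∀ y ∈ Set.Icc (-R) R, |G.eval y| ≤ ∫ x in Set.Icc (-R) R, |p.eval x| := by
    intro y hy
    have hi : ∫ x in (-R)..y, p.eval x = G.eval y := by
      rw [intervalIntegral.integral_eq_sub_of_hasDerivAt (f := fun x => G.eval x)]
      · simp [hG]
      · intro x _; rw [← hGp]; exact G.hasDerivAt x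
      · exact p.continuous.intervalIntegrable _ _
    rw [← hi, integral_Icc_eq_integral_Ioc, ← intervalIntegral.integral_of_le (by linarith)]
    refine (intervalIntegral.abs_integral_le_integral_abs hy.1).trans ?_
    refine intervalIntegral.integral_mono_interval le_rfl hy.1 hy.2
      (Filter.Eventually.of_forall fun x => abs_nonneg _) ?_
    exact p.continuous.abs.intervalIntegrable _ _
  have h := interp_bound R hR ℓ hl G hGd _ hb (m + 1)
  have hc : p.coeff m = G.coeff (m + 1) * (m + 1) := by
    rw [← hGp, Polynomial.coeff_derivative]
  rw [hc, abs_mul, mul_comm, abs_of_nonneg (by positivity : (0 : ℝ) ≤ m + 1)]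
  exact mul_le_mul (by exact_mod_cast hm) h (abs_nonneg _) (by positivity)

lemma gaussd_lower (R x : ℝ) (hx : x ∈ Set.Icc (-R) R) : gaussd 0 R ≤ gaussd 0 x := by
  unfold gaussd
  have : x ^ 2 ≤ R ^ 2 := sq_le_sq' hx.1 hx.2
  refine mul_le_mul_of_nonneg_left (Real.exp_le_exp.mpr ?_) (by positivity)
  simp only [sub_zero]
  linarith

lemma lin_expand (T : Polynomial ℝ →ₗ[ℝ] ℝ) (p : Polynomial ℝ) (ℓ : ℕ) (hp : p.degree < ℓ) :
    T p = ∑ m ∈ Finset.range ℓ, p.coeff m * T (Polynomial.X ^ m) := by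
  have h : p = ∑ m ∈ Finset.range ℓ, p.coeff m • Polynomial.X ^ m := by
    rw [Polynomial.degree_lt_iff_coeff_zero] at hp
    ext j
    rw [Polynomial.finsetSum_coeff]
    simp only [Polynomial.coeff_smul, Polynomial.coeff_X_pow, smul_eq_mul, mul_ite, mul_one,
      mul_zero, Finset.sum_ite_eq, Finset.mem_range]
    split_ifs with hj
    · rfl
    · exact hp j (by omega)
  conv_lhs => rw [h]
  simp

lemma Q_bound (R : ℝ) (hR : 0 < R) (ℓ : ℕ) (hl : 2 ≤ ℓ) (p : Polynomial ℝ)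
    (hp : p.degree < ℓ) (B : ℝ) (hB : 0 ≤ B) (hL : ∀ r, r < ℓ → |Lfun R p (HP r)| ≤ B)
    (A : ℝ) (hA : A = ℓ * (ℓ * ((ℓ + 1) * ((ℓ / (2 * R)) * (1 + R)) ^ ℓ) * (B * (ℓ : ℝ) ^ ℓ))) :
    ∫ x in Set.Icc (-R) R, gaussd 0 x * p.eval x ^ 2 ≤ 2 * R * A ^ 2 / gaussd 0 R := by
  have hl' : (1 : ℝ) ≤ ℓ := by exact_mod_cast (by omega : 1 ≤ ℓ)
  have hcg := measurable_gaussd 0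
  have hcp := p.continuous
  have hA0 : 0 ≤ A := by rw [hA]; positivity
  set Q := ∫ x in Set.Icc (-R) R, gaussd 0 x * p.eval x ^ 2 with hQ
  set I := ∫ x in Set.Icc (-R) R, |p.eval x| with hI
  have hI0 : 0 ≤ I := integral_nonneg fun x => abs_nonneg _
  have hg0 : 0 < gaussd 0 R := by unfold gaussd; positivity
  have hQL : Q = Lfun R p p := by
    simp only [Lfun, LinearMap.coe_mk, AddHom.coe_mk, hQ]
    congr 1; ext x; ring
  have h1 : Q ≤ A * I := by
    rw [hQL]
    rw [lin_expand _ p ℓ hp]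
    refine (le_abs_self _).trans ((Finset.abs_sum_le_sum_abs _ _).trans ?_)
    refine (Finset.sum_le_card_nsmul _ _
      (ℓ * ((ℓ + 1) * (I * ((ℓ / (2 * R)) * (1 + R)) ^ ℓ)) * (B * (ℓ : ℝ) ^ ℓ)) ?_).trans ?_
    · intro m hm
      have hm := Finset.mem_range.mp hm
      rw [abs_mul]
      refine mul_le_mul (coeff_le_L1 R hR ℓ (by omega) p hp m hm) ?_ (abs_nonneg _) (by positivity)
      have := functional_bound (Lfun R p) ℓ B hB hL m 0 (by omega)
      rw [HP_zero, mul_one] at this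
      refine this.trans ?_
      gcongr
    · rw [Finset.card_range, nsmul_eq_mul, hA]
      apply le_of_eq; ring
  have h2 : A * I ≤ 2 * R * (A ^ 2 / (2 * gaussd 0 R)) + Q / 2 := by
    rw [hI, ← integral_const_mul]
    have e : 2 * R * (A ^ 2 / (2 * gaussd 0 R)) + Q / 2 =
        ∫ x in Set.Icc (-R) R, (A ^ 2 / (2 * gaussd 0 R) + (gaussd 0 x * p.eval x ^ 2) / 2) := by
      have eQ : ∫ x in Set.Icc (-R) R, (gaussd 0 x * p.eval x ^ 2) / 2 = Q / 2 := by
        rw [hQ, integral_div]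
      rw [integral_add (Continuous.integrableOn_Icc (by fun_prop))
        (Continuous.integrableOn_Icc (by fun_prop)), eQ, setIntegral_const,
        Real.volume_real_Icc, max_eq_left (by linarith), smul_eq_mul]
      ring
    rw [e]
    refine setIntegral_mono_on (Continuous.integrableOn_Icc (by fun_prop))
        (Continuous.integrableOn_Icc (by fun_prop)) measurableSet_Icc ?_
    intro x hx
    have hg := gaussd_lower R x hx
    have h3 : gaussd 0 R * p.eval x ^ 2 ≤ gaussd 0 x * p.eval x ^ 2 :=
      mul_le_mul_of_nonneg_right hg (sq_nonneg _)
    have h4 : A * |p.eval x| ≤ A ^ 2 / (2 * gaussd 0 R) + gaussd 0 R * p.eval x ^ 2 / 2 := by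
      have e2 : A ^ 2 / (2 * gaussd 0 R) + gaussd 0 R * p.eval x ^ 2 / 2 - A * |p.eval x|
          = (A - gaussd 0 R * |p.eval x|) ^ 2 / (2 * gaussd 0 R) := by
        rw [← sq_abs (p.eval x)]
        field_simp; ring
      have : 0 ≤ (A - gaussd 0 R * |p.eval x|) ^ 2 / (2 * gaussd 0 R) := by positivity
      linarith
    linarith
  have e3 : 2 * R * A ^ 2 / gaussd 0 R = 2 * (2 * R * (A ^ 2 / (2 * gaussd 0 R))) := by
    field_simp
  rw [e3]; linarith

lemma gaussd_ratio (R M m x : ℝ) (hm : m ∈ Set.Icc (-M) M) (hx : x ∈ Set.Icc (-R) R) :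
    gaussd m x ≤ Real.exp (M * R) * gaussd 0 x := by
  unfold gaussd
  rw [mul_left_comm, ← Real.exp_add]
  gcongr
  have : m * x ≤ M * R := by
    refine (le_abs_self _).trans ?_
    rw [abs_mul]
    exact mul_le_mul (abs_le.mpr hm) (abs_le.mpr hx) (abs_nonneg _) ((abs_nonneg _).trans (abs_le.mpr hm))
  nlinarith [sq_nonneg m]

lemma mix_bound (R M : ℝ) (k : ℕ) (w μ : Fin k → ℝ) (hw : ∀ t, 0 < w t) (hs : ∑ t, w t = 1)
    (hμ : ∀ t, μ t ∈ Set.Icc (-M) M) (p : Polynomial ℝ) :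
    ∫ x in Set.Icc (-R) R, (∑ t, w t * gaussd (μ t) x) * p.eval x ^ 2 ≤
      Real.exp (M * R) * ∫ x in Set.Icc (-R) R, gaussd 0 x * p.eval x ^ 2 := by
  have h0 := dens_cont k w μ
  have hcg := measurable_gaussd 0
  have hcp := p.continuous
  rw [← integral_const_mul]
  refine setIntegral_mono_on (Continuous.integrableOn_Icc (by fun_prop))
        (Continuous.integrableOn_Icc (by fun_prop)) measurableSet_Icc ?_
  intro x hx
  rw [← mul_assoc]
  refine mul_le_mul_of_nonneg_right ?_ (sq_nonneg _)
  calc ∑ t, w t * gaussd (μ t) x ≤ ∑ t, w t * (Real.exp (M * R) * gaussd 0 x) :=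
        Finset.sum_le_sum fun t _ => mul_le_mul_of_nonneg_left (gaussd_ratio R M _ x (hμ t) hx) (hw t).le
    _ = _ := by rw [← Finset.sum_mul, hs, one_mul]

lemma numeric (R M : ℝ) (hR : 0 < R) : ∃ C : ℝ, 0 < C ∧ ∀ ℓ : ℕ, 2 ≤ ℓ → ∀ A B : ℝ,
    0 ≤ B → B ≤ (ℓ : ℝ) ^ ℓ →
    A = ℓ * (ℓ * ((ℓ + 1) * ((ℓ / (2 * R)) * (1 + R)) ^ ℓ) * (B * (ℓ : ℝ) ^ ℓ)) →
    Real.exp (M * R) * (2 * R * A ^ 2 / gaussd 0 R) ≤ (2 : ℝ) ^ (C * ℓ * Real.log ℓ) := by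
  have hg0 : 0 < gaussd 0 R := by unfold gaussd; positivity
  set K1 := Real.exp (M * R) * (2 * R) / gaussd 0 R with hK1
  set K0 := (1 + R) / (2 * R) with hK0
  have hK1p : 0 < K1 := by positivity
  have hK0p : 0 < K0 := by positivity
  set K := (1 + K1) * (1 + K0) ^ 2 with hK
  have hKge : 1 ≤ K := by rw [hK]; nlinarith [mul_pos hK1p hK0p, mul_pos hK1p (mul_pos hK0p hK0p)]
  have hlogK : 0 ≤ Real.log K := Real.log_nonneg hKge
  have hlog2 : 0 < Real.log 2 := Real.log_pos (by norm_num)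
  refine ⟨(Real.log K / Real.log 2 + 12) / Real.log 2, by positivity, ?_⟩
  intro ℓ hl A B hB0 hB hA
  have hl2 : (2 : ℝ) ≤ ℓ := by exact_mod_cast hl
  have hl0 : (0 : ℝ) < ℓ := by linarith
  have hll : Real.log 2 ≤ Real.log ℓ := Real.log_le_log (by norm_num) hl2
  have hp1 : (ℓ : ℝ) ≤ (ℓ : ℝ) ^ ℓ := le_self_pow₀ (by linarith) (by omega)
  have hp2 : (ℓ : ℝ) + 1 ≤ (ℓ : ℝ) ^ ℓ := by
    calc (ℓ : ℝ) + 1 ≤ (ℓ : ℝ) ^ 2 := by nlinarith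
      _ ≤ _ := pow_le_pow_right₀ (by linarith) hl
  have hA0 : 0 ≤ A := by rw [hA]; positivity
  set P := (ℓ : ℝ) ^ ℓ with hP
  have hPp : 0 < P := by positivity
  have hAle : A ≤ P ^ 6 * (1 + K0) ^ ℓ := by
    have e : ((ℓ / (2 * R)) * (1 + R)) ^ ℓ = P * K0 ^ ℓ := by
      rw [hP, hK0, ← mul_pow]; congr 1; ring
    have hk : K0 ^ ℓ ≤ (1 + K0) ^ ℓ := by gcongr; linarith
    rw [hA, e]
    calc ℓ * (ℓ * ((ℓ + 1) * (P * K0 ^ ℓ)) * (B * P))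
        ≤ P * (P * (P * (P * (1 + K0) ^ ℓ)) * (P * P)) := by gcongr
      _ = _ := by ring
  have hfin : Real.exp (M * R) * (2 * R * A ^ 2 / gaussd 0 R) ≤ (K * (ℓ : ℝ) ^ 12) ^ ℓ := by
    have e : Real.exp (M * R) * (2 * R * A ^ 2 / gaussd 0 R) = K1 * A ^ 2 := by rw [hK1]; ring
    have h1 : K1 ≤ (1 + K1) ^ ℓ := by
      calc K1 ≤ 1 + K1 := by linarith
        _ ≤ _ := le_self_pow₀ (by linarith) (by omega)
    rw [e]
    calc K1 * A ^ 2 ≤ (1 + K1) ^ ℓ * (P ^ 6 * (1 + K0) ^ ℓ) ^ 2 := by gcongr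
      _ = _ := by
        rw [hK, hP, mul_pow _ _ ℓ, mul_pow _ _ ℓ, mul_pow _ _ 2, ← pow_mul, ← pow_mul, ← pow_mul, ← pow_mul, ← pow_mul,
          mul_comm 2 ℓ, mul_comm 12 ℓ]
        ring
  refine hfin.trans ?_
  rw [Real.rpow_def_of_pos (by norm_num), ← Real.exp_log (by positivity : 0 < (K * (ℓ : ℝ) ^ 12) ^ ℓ)]
  rw [Real.log_pow, Real.log_mul (by positivity) (by positivity), Real.log_pow]
  refine Real.exp_le_exp.mpr ?_
  have e : Real.log 2 * ((Real.log K / Real.log 2 + 12) / Real.log 2 * ℓ * Real.log ℓ)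
     = ℓ * ((Real.log K * (Real.log ℓ / Real.log 2) + 12 * Real.log ℓ)) := by
    field_simp
  rw [e]
  have : 1 ≤ Real.log ℓ / Real.log 2 := by rwa [le_div_iff₀ hlog2, one_mul]
  push_cast
  gcongr
  exact le_mul_of_one_le_right hlogK this

lemma Lfun_HP (R : ℝ) (ℓ : ℕ) (i : Fin ℓ) (hV : IsUnit (Vmat R ℓ).det) (β : Fin ℓ → ℝ)
    (hβ : β = (Vmat R ℓ)⁻¹ *ᵥ Pi.single i (1 : ℝ)) (r : Fin ℓ) :
    Lfun R (∑ a : Fin ℓ, β a • HP a) (HP r) = (r : ℕ).factorial * (Pi.single i (1 : ℝ) : Fin ℓ → ℝ) r := by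
  have h1 : Vmat R ℓ *ᵥ β = Pi.single i (1 : ℝ) := by
    rw [hβ, Matrix.mulVec_mulVec, Matrix.mul_nonsing_inv _ hV, Matrix.one_mulVec]
  rw [← h1]
  simp only [Lfun, LinearMap.coe_mk, AddHom.coe_mk, Matrix.mulVec, dotProduct, Vmat, Matrix.of_apply,
    Jint]
  rw [Finset.mul_sum]
  have hcg := measurable_gaussd 0
  have hc : ∀ a, Continuous (hermiteR a) := by
    intro a
    have : hermiteR a = fun x => (HP a).eval x := funext (hermiteR_eq a)
    rw [this]; exact (HP a).continuous
  have hf : ((r : ℕ).factorial : ℝ) ≠ 0 := by positivity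
  have e : ∀ x : ℝ, Polynomial.eval x (∑ a : Fin ℓ, β a • HP a) * gaussd 0 x * (HP r).eval x =
      ∑ a : Fin ℓ, (r : ℕ).factorial * (β a * (hermiteR a x * (1 / (Real.sqrt (2 * π) * (Nat.factorial r))) * Real.exp (-x ^ 2 / 2) * hermiteR r x)) := by
    intro x
    rw [Polynomial.eval_finsetSum, Finset.sum_mul, Finset.sum_mul]
    refine Finset.sum_congr rfl fun a _ => ?_
    rw [hermiteR_eq, hermiteR_eq, gaussd, Polynomial.eval_smul, smul_eq_mul, sub_zero]
    field_simp
  simp_rw [e]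
  rw [integral_finsetSum]
  · refine Finset.sum_congr rfl fun a _ => ?_
    rw [integral_const_mul, integral_const_mul]
    ring
  · intro a _
    have := hc a
    have := hc r
    exact Continuous.integrableOn_Icc (by fun_prop)

/-- Variance bound for the estimator `m̂ᵢ = (1/n) ∑_s f̂ᵢ(X_s)` under `n` i.i.d. samples from the
censored model, where `f̂ᵢ(some x) = fᵢ(x) = ∑_a (βᵢ)_a h_a(x)`, `f̂ᵢ(none) = 0`, and
`βᵢ = V⁻¹ eᵢ`. -/
theorem variance_estimator_le (R M : ℝ) (hR : 0 < R) (hM : 0 < M) :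
    ∃ C : ℝ, 0 < C ∧
      ∀ k : ℕ, 1 ≤ k → ∀ ℓ : ℕ, 2 * (2 * k - 1) ≤ ℓ →
        ∀ i : ℕ, 1 ≤ i → i ≤ 2 * k - 1 → ∀ hi : i < ℓ, ∀ n : ℕ, 1 ≤ n →
          ∀ w μ : Fin k → ℝ, (∀ t, 0 < w t) → ∑ t, w t = 1 →
            (∀ t, μ t ∈ Set.Icc (-M) M) →
            ProbabilityTheory.variance
                (fun xs : Fin n → Option ℝ =>
                  (1 / (n : ℝ)) * ∑ s : Fin n,
                    (xs s).elim 0 fun x => ∑ a : Fin ℓ,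
                      ((Vmat R ℓ)⁻¹ *ᵥ Pi.single (⟨i, hi⟩ : Fin ℓ) (1 : ℝ)) a * hermiteR a x)
                (Measure.pi fun _ : Fin n => censored R k w μ) ≤
              (1 / (n : ℝ)) * (2 : ℝ) ^ (C * ℓ * Real.log ℓ) := by
  obtain ⟨C, hC, hnum⟩ := numeric R M hR
  refine ⟨C, hC, ?_⟩
  intro k hk ℓ hℓ i hi1 hi2 hi n hn w μ hw hs hμ
  have hl : 2 ≤ ℓ := by omega
  set β := (Vmat R ℓ)⁻¹ *ᵥ Pi.single (⟨i, hi⟩ : Fin ℓ) (1 : ℝ) with hβ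
  set p : Polynomial ℝ := ∑ a : Fin ℓ, β a • HP a with hp
  have hpe : (fun x => ∑ a : Fin ℓ, β a * hermiteR a x) = fun x => p.eval x := by
    ext x
    rw [hp, Polynomial.eval_finsetSum]
    simp [hermiteR_eq]
  rw [hpe]
  refine (var_bound R k w μ hw hs _ p.continuous n hn).trans ?_
  refine mul_le_mul_of_nonneg_left ?_ (by positivity)
  by_cases hV : IsUnit (Vmat R ℓ).det
  · refine (mix_bound R M k w μ hw hs hμ p).trans ?_
    have hdeg : p.degree < ℓ := by
      rw [hp, ← Polynomial.mem_degreeLT]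
      refine Submodule.sum_mem _ fun a _ => ?_
      rw [Polynomial.mem_degreeLT]
      refine (Polynomial.degree_smul_le _ _).trans_lt ?_
      rw [HP_degree]
      exact_mod_cast a.2
    have hQ := Q_bound R hR ℓ hl p hdeg (i.factorial) (by positivity) (by
      intro r hr
      have := Lfun_HP R ℓ ⟨i, hi⟩ hV β hβ ⟨r, hr⟩
      rw [hp]
      simp only at this
      rw [this]
      by_cases h : r = i
      · subst h; simp
      · rw [Pi.single_eq_of_ne (by simpa using h)]; simp) _ rfl
    refine (mul_le_mul_of_nonneg_left hQ (Real.exp_pos _).le).trans ?_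
    refine hnum ℓ hl _ _ (by positivity) ?_ rfl
    have h1 : i.factorial ≤ ℓ ^ ℓ :=
      (Nat.factorial_le hi.le).trans (Nat.factorial_le_pow ℓ)
    exact_mod_cast h1
  · have hz : p = 0 := by
      have : β = 0 := by
        rw [hβ, Matrix.nonsing_inv_apply_not_isUnit _ hV, Matrix.zero_mulVec]
      rw [hp, this]; simp
    rw [hz]
    simp only [Polynomial.eval_zero, ne_eq, OfNat.ofNat_ne_zero, not_false_eq_true, zero_pow,
      mul_zero, integral_zero]
    positivity
end
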